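/- Let X be a primitive cyclically reduced word, and let (i,j) and (k,h) be linking pairs in I(X,X) that are not equivalent under R(X,X). Let p and q be distinct positive integers such that p ≥ 3 or q ≥ 3. Then the images in the free group FreeGroup S of the concatenated words (X_i)^p (X_j)^q and (X_k)^p (X_h)^q are not conjugate. -/

import Mathlib

namespace GoldmanPaper

variable {α : Type*} [Inhabited α]

/-- The letter of `V` at index `i`, indices taken modulo the length of `V`. -/
def letterZ (V : List α) (i : ZMod V.length) : α := V.getD i.val default

/-- The cyclic rotation `V_i` for an index `i` mod the length of `V`. -/
def rotZ (V : List α) (i : ZMod V.length) : List α := V.rotate i.val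

/-- The cyclic rotation `V_j` for an integer `j` (taken mod the length of `V`). -/
def rot (V : List α) (j : ℤ) : List α := V.rotate ((j % (V.length : ℤ)).toNat)

/-- `V^k`: the concatenation of `k` copies of `V`. -/
def wpow (V : List α) (k : ℕ) : List α := (List.replicate k V).flatten

/-- A word is primitive if it is not of the form `W^r` with `r ≥ 2`. -/
def Primitive (V : List α) : Prop := ¬ ∃ (W : List α) (r : ℕ), 2 ≤ r ∧ V = wpow W r

/-- `V` is freely reduced: `v_{i+1} ≠ bar v_i` for all `i`. -/
def FreelyReduced (bar : α → α) (V : List α) : Prop :=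
  ∀ i : ℕ, i + 1 < V.length → V.getD (i + 1) default ≠ bar (V.getD i default)

/-- `V` is cyclically reduced: nonempty, freely reduced, and `v_0 ≠ bar v_{n-1}`. -/
def CyclicallyReduced (bar : α → α) (V : List α) : Prop :=
  V ≠ [] ∧ FreelyReduced bar V ∧ V.getD 0 default ≠ bar (V.getD (V.length - 1) default)

/-- The generating step of the equivalence relation `R(V,W)` on `I(V,W)`:
rule 1 relates `(j,k)` with `(j+1,k+1)` whenever `v_j = w_k`; rule 2 relates
`(j+1,k)` with `(j,k+1)` whenever `v_j = bar w_k`. -/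
def Step (bar : α → α) (V W : List α) :
    ZMod V.length × ZMod W.length → ZMod V.length × ZMod W.length → Prop :=
  fun p q =>
    (q = (p.1 + 1, p.2 + 1) ∧ letterZ V p.1 = letterZ W p.2) ∨
    (q = (p.1 - 1, p.2 + 1) ∧ letterZ V (p.1 - 1) = bar (letterZ W p.2))

/-- The equivalence relation `R(V,W)` generated by rules 1 and 2. -/
def REq (bar : α → α) (V W : List α) :
    ZMod V.length × ZMod W.length → ZMod V.length × ZMod W.length → Prop :=
  Relation.EqvGen (Step bar V W)

/-- A pair `(i,j) ∈ I(V,W)` is extremal if `v_i ≠ w_j` and `v_i ≠ bar w_{j-1}`. -/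
def Extremal (bar : α → α) (V W : List α) (p : ZMod V.length × ZMod W.length) : Prop :=
  letterZ V p.1 ≠ letterZ W p.2 ∧ letterZ V p.1 ≠ bar (letterZ W (p.2 - 1))

section Order

variable [LinearOrder α]

/-- The order on `α` cyclically rotated so that `x` is the smallest element. -/
def cycLT (x a b : α) : Prop :=
  if (x ≤ a ∧ x ≤ b) ∨ (a < x ∧ b < x) then a < b else x ≤ a ∧ b < x

/-- The order on half-infinite words. -/
def hwLT (bar : α → α) (T U : ℕ → α) : Prop :=
  T 0 < U 0 ∨ ∃ j : ℕ, (∀ i ≤ j, T i = U i) ∧ cycLT (bar (T j)) (T (j + 1)) (U (j + 1))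

/-- A 4-tuple is linearly ordered: strictly increasing or strictly decreasing. -/
def LinOrd4 {β : Type*} (lt : β → β → Prop) (a b c d : β) : Prop :=
  (lt a b ∧ lt b c ∧ lt c d) ∨ (lt d c ∧ lt c b ∧ lt b a)

/-- A 4-tuple is cyclically ordered: some cyclic permutation is linearly ordered. -/
def CycOrd4 {β : Type*} (lt : β → β → Prop) (a b c d : β) : Prop :=
  LinOrd4 lt a b c d ∨ LinOrd4 lt b c d a ∨ LinOrd4 lt c d a b ∨ LinOrd4 lt d a b c

/-- The half-infinite word `V_i^∞`. -/
def fwd (V : List α) (i : ZMod V.length) : ℕ → α :=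
  fun t => letterZ V (i + (t : ZMod V.length))

/-- The half-infinite word `V_i^{-∞} = (bar V_i)^∞`. -/
def bwd (bar : α → α) (V : List α) (i : ZMod V.length) : ℕ → α :=
  fun t => bar (letterZ V (i - 1 - (t : ZMod V.length)))

open scoped Classical in
/-- The sign `s_{V,W}(i,j) ∈ {-1,0,1}`. -/
noncomputable def sgn (bar : α → α) (V W : List α)
    (i : ZMod V.length) (j : ZMod W.length) : ℤ :=
  if CycOrd4 (hwLT bar) (fwd V i) (fwd W j) (bwd bar V i) (bwd bar W j) then 1
  else if CycOrd4 (hwLT bar) (fwd V i) (bwd bar W j) (bwd bar V i) (fwd W j) then -1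
  else 0

end Order

/-- The involution `bar` on the alphabet `S × Bool`. -/
def pbar {S : Type*} : S × Bool → S × Bool := fun p => (p.1, !p.2)


/-! ### Conjugacy of cyclically reduced words -/

theorem pbar_pbar {S : Type*} (x : S × Bool) : pbar (pbar x) = x := by
  simp [pbar]

theorem pbar_ne {S : Type*} (x : S × Bool) : pbar x ≠ x := by
  intro h
  have := congrArg Prod.snd h
  simp [pbar] at this

theorem rel_iff_ne {S : Type*} (a b : S × Bool) : (a.1 = b.1 → a.2 = b.2) ↔ b ≠ pbar a := by
  obtain ⟨a1, a2⟩ := a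
  obtain ⟨b1, b2⟩ := b
  simp only [pbar, ne_eq, Prod.mk.injEq, not_and]
  constructor
  · intro h h1 h2
    have := h h1.symm
    subst this
    simp at h2
  · intro h h1
    have := h h1.symm
    cases a2 <;> cases b2 <;> simp_all

theorem mk_pbar {S : Type*} (a : S × Bool) :
    FreeGroup.mk [pbar a] = (FreeGroup.mk [a])⁻¹ := by
  simp [FreeGroup.inv_mk, FreeGroup.invRev, pbar]

theorem isReduced_iff_chain {S : Type*} (w : List (S × Bool)) :
    FreeGroup.IsReduced w ↔ w.IsChain (fun a b => b ≠ pbar a) := by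
  unfold FreeGroup.IsReduced
  simp only [rel_iff_ne]

theorem cyc_iff {S : Type*} (w : List (S × Bool)) :
    FreeGroup.IsCyclicallyReduced w ↔ w.IsChain (fun a b => b ≠ pbar a) ∧
      ∀ a ∈ w.getLast?, ∀ b ∈ w.head?, b ≠ pbar a := by
  unfold FreeGroup.IsCyclicallyReduced
  rw [isReduced_iff_chain]
  simp only [rel_iff_ne]

theorem cyc_rot {S : Type*} (b : S × Bool) (l : List (S × Bool)) :
    FreeGroup.IsCyclicallyReduced (b :: l) ↔ FreeGroup.IsCyclicallyReduced (l ++ [b]) := by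
  rw [cyc_iff, cyc_iff]
  by_cases hl : l = []
  · subst hl; simp
  · obtain ⟨c, l', rfl⟩ := List.exists_cons_of_ne_nil hl
    have e1 : (b :: c :: l').getLast? = (c :: l').getLast? := by
      rw [← List.singleton_append, List.getLast?_append_of_ne_nil _ (by simp)]
    rw [e1, List.isChain_cons, List.isChain_append, List.getLast?_concat]
    simp only [List.head?_cons, List.cons_append, Option.mem_def, Option.some.injEq,
      List.isChain_singleton, true_and, forall_eq']
    tauto

theorem chain_invRev {S : Type*} (u : List (S × Bool)) (hu : FreeGroup.IsReduced u) :
    FreeGroup.IsReduced (FreeGroup.invRev u) := by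
  classical
  rw [FreeGroup.isReduced_iff_reduce_eq] at *
  rw [FreeGroup.reduce_invRev, hu]

theorem eq_of_mk_eq {S : Type*} (w w' : List (S × Bool)) (hw : FreeGroup.IsReduced w)
    (hw' : FreeGroup.IsReduced w') (h : FreeGroup.mk w = FreeGroup.mk w') : w = w' := by
  classical
  have := FreeGroup.reduce.sound h
  rwa [hw.reduce_eq, hw'.reduce_eq] at this

theorem conj_rot_aux {S : Type*} (u : List (S × Bool)) : ∀ w w' : List (S × Bool),
    FreeGroup.IsReduced u → FreeGroup.IsCyclicallyReduced w → FreeGroup.IsCyclicallyReduced w' →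
    FreeGroup.mk u * FreeGroup.mk w * (FreeGroup.mk u)⁻¹ = FreeGroup.mk w' → w ~r w' := by
  induction u using List.reverseRecOn with
  | nil =>
    intro w w' _ hw hw' h
    have h1 : FreeGroup.mk w = FreeGroup.mk w' := by
      rw [← h, ← FreeGroup.one_eq_mk, one_mul, inv_one, mul_one]
    rw [eq_of_mk_eq w w' hw.1 hw'.1 h1]
  | append_singleton u a ih =>
    intro w w' hu hw hw' h
    have hu' : FreeGroup.IsReduced u := hu.infix ⟨[], [a], by simp⟩
    rw [← FreeGroup.mul_mk] at h
    rcases w with _ | ⟨b, w1⟩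
    · have h1 : FreeGroup.mk ([] : List (S × Bool)) = FreeGroup.mk w' := by
        rw [← h, ← FreeGroup.one_eq_mk, mul_one, mul_inv_cancel]
      rw [eq_of_mk_eq _ w' hw.1 hw'.1 h1]
    by_cases h1 : b = pbar a
    · subst h1
      have := ih (w1 ++ [pbar a]) w' hu' ((cyc_rot _ _).1 hw) hw' (by
        have e : FreeGroup.mk (pbar a :: w1) = FreeGroup.mk [pbar a] * FreeGroup.mk w1 := rfl
        rw [← h, ← FreeGroup.mul_mk, e, mk_pbar]
        group)
      exact (List.IsRotated.cons_append_singleton).trans this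
    by_cases h2 : (b :: w1).getLast (by simp) = a
    · have e : b :: w1 = (b :: w1).dropLast ++ [a] := by
        conv_lhs => rw [← List.dropLast_append_getLast (l := b :: w1) (by simp), h2]
      rw [e] at h hw ⊢
      have := ih (a :: (b :: w1).dropLast) w' hu' ((cyc_rot _ _).2 hw) hw' (by
        have e : FreeGroup.mk (a :: (b :: w1).dropLast)
          = FreeGroup.mk [a] * FreeGroup.mk (b :: w1).dropLast := rfl
        rw [← h, ← FreeGroup.mul_mk, e]
        group)
      exact (List.IsRotated.cons_append_singleton).symm.trans this
    exfalso
    have hred : FreeGroup.IsReduced ((u ++ [a]) ++ (b :: w1) ++ FreeGroup.invRev (u ++ [a])) := by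
      have hinv := chain_invRev _ hu
      have e1 : FreeGroup.invRev (u ++ [a]) = pbar a :: FreeGroup.invRev u := by
        simp [FreeGroup.invRev, pbar]
      rw [e1] at hinv ⊢
      rw [isReduced_iff_chain] at *
      have hw1 := (cyc_iff _).1 hw
      rw [List.isChain_append, List.isChain_append]
      refine ⟨⟨hu, hw1.1, ?_⟩, hinv, ?_⟩
      · simpa using h1
      · intro x hx y hy
        simp only [List.head?_cons, Option.mem_def, Option.some.injEq] at hy
        subst hy
        rw [List.getLast?_append_of_ne_nil _ (by simp), List.getLast?_eq_some_getLast (by simp)] at hx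
        simp only [Option.mem_def, Option.some.injEq] at hx
        rw [hx] at h2
        intro hc
        apply h2
        rw [← pbar_pbar x, ← hc, pbar_pbar]
    have heq := eq_of_mk_eq _ w' hred hw'.1 (by
      rw [← h, ← FreeGroup.mul_mk, ← FreeGroup.mul_mk, ← FreeGroup.mul_mk, ← FreeGroup.inv_mk,
        ← FreeGroup.mul_mk])
    have hc := ((cyc_iff _).1 hw').2
    rw [← heq] at hc
    rcases u with _ | ⟨c, u⟩
    · exact hc (pbar a) (by
        rw [List.getLast?_append_of_ne_nil _ (by simp [FreeGroup.invRev])]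
        rw [FreeGroup.invRev, List.getLast?_reverse]
        simp [pbar]) a (by simp) (pbar_pbar a).symm
    · exact hc (pbar c) (by
        rw [List.getLast?_append_of_ne_nil _ (by simp [FreeGroup.invRev])]
        rw [FreeGroup.invRev, List.getLast?_reverse]
        simp [pbar]) c (by simp) (pbar_pbar c).symm

theorem conj_rot {S : Type*} (w w' : List (S × Bool)) (hw : FreeGroup.IsCyclicallyReduced w)
    (hw' : FreeGroup.IsCyclicallyReduced w') (h : IsConj (FreeGroup.mk w) (FreeGroup.mk w')) :
    w ~r w' := by
  classical
  obtain ⟨c, hc⟩ := isConj_iff.1 h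
  apply conj_rot_aux c.toWord w w' FreeGroup.isReduced_toWord hw hw'
  rw [FreeGroup.mk_toWord, hc]

/-! ### Windows of a periodic sequence -/

/-- The word `s a, s (a+1), …, s (a+m-1)`. -/
def win {β : Type*} (s : ℤ → β) (a : ℤ) (m : ℕ) : List β :=
  (List.range m).map (fun t : ℕ => s (a + t))

theorem win_length {β : Type*} (s : ℤ → β) (a : ℤ) (m : ℕ) : (win s a m).length = m := by
  simp [win]

theorem win_getElem {β : Type*} (s : ℤ → β) (a : ℤ) (m t : ℕ) (h : t < (win s a m).length) :
    (win s a m)[t] = s (a + t) := by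
  simp [win]

theorem win_add {β : Type*} (s : ℤ → β) (a : ℤ) (m m' : ℕ) :
    win s a (m + m') = win s a m ++ win s (a + m) m' := by
  simp only [win, List.range_add, List.map_append, List.map_map]
  congr 1
  apply List.map_congr_left
  intro t _
  simp [add_assoc]

theorem per_mul {β : Type*} {s : ℤ → β} {n : ℤ} (per : ∀ t, s (t + n) = s t) (m : ℤ) (t : ℤ) :
    s (t + n * m) = s t := by
  induction m using Int.induction_on with
  | zero => simp
  | succ m ih => rw [mul_add, mul_one, ← add_assoc, per, ih]
  | pred m ih => rw [← ih, ← per (t + n * (-m - 1))]; congr 1; ring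

theorem per_dvd {β : Type*} {s : ℤ → β} {n : ℤ} (per : ∀ t, s (t + n) = s t) {t u : ℤ}
    (h : n ∣ t - u) : s t = s u := by
  obtain ⟨m, hm⟩ := h
  rw [← per_mul per m u]; congr 1; linarith

theorem win_congr {β : Type*} {s : ℤ → β} {n : ℤ} (per : ∀ t, s (t + n) = s t) {a b : ℤ} (m : ℕ)
    (h : n ∣ a - b) : win s a m = win s b m := by
  unfold win
  apply List.map_congr_left
  intro t _
  apply per_dvd per
  simpa using h

theorem win_mul {β : Type*} {s : ℤ → β} {n : ℕ} (per : ∀ t, s (t + n) = s t) (a : ℤ) (r : ℕ) :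
    win s a (n * r) = wpow (win s a n) r := by
  induction r with
  | zero => simp [win, wpow]
  | succ r ih =>
    rw [mul_add, mul_one, add_comm (n * r), win_add, wpow, List.replicate_succ, List.flatten_cons]
    rw [win_congr per (b := a) (n * r) (by simp), ih, wpow]

theorem win_chain {S : Type*} {s : ℤ → S × Bool} (red : ∀ t, s (t + 1) ≠ pbar (s t)) (a : ℤ)
    (m : ℕ) : (win s a m).IsChain (fun a b => b ≠ pbar a) := by
  rw [List.isChain_iff_getElem]
  intro t ht
  rw [win_getElem, win_getElem]
  have := red (a + t)
  push_cast
  rwa [← add_assoc]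

theorem win_head {β : Type*} (s : ℤ → β) (a : ℤ) (m : ℕ) (hm : 0 < m) :
    (win s a m).head? = some (s a) := by
  obtain ⟨m, rfl⟩ := Nat.exists_eq_succ_of_ne_zero hm.ne'
  simp [win, List.range_succ_eq_map]

theorem win_last {β : Type*} (s : ℤ → β) (a : ℤ) (m : ℕ) (hm : 0 < m) :
    (win s a m).getLast? = some (s (a + m - 1)) := by
  obtain ⟨m, rfl⟩ := Nat.exists_eq_succ_of_ne_zero hm.ne'
  simp only [win, List.range_succ, List.map_append, List.map_cons, List.map_nil,
    List.getLast?_concat]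
  congr 2
  push_cast; ring

/-- Normal form data for a pair of indices, `l` being the length of the oppositely oriented
overlap. -/
structure NF {S : Type*} (s : ℤ → S × Bool) (n : ℕ) (i j : ℤ) (l : ℕ) : Prop where
  lt : l < n
  ov : ∀ t : ℕ, t < l → s (i + t) = pbar (s (j - 1 - t))
  b : s (i - 1) ≠ pbar (s j)
  c : s (i + l) ≠ pbar (s (j - 1 - l))

/-- The cyclically reduced word attached to normal form data. -/
def nfw {S : Type*} (s : ℤ → S × Bool) (n : ℕ) (i j : ℤ) (l p q : ℕ) : List (S × Bool) :=
  win s (i + l) (n * p - l) ++ win s j (n * q - l)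

theorem ne_pbar_symm {S : Type*} {x y : S × Bool} (h : x ≠ pbar y) : y ≠ pbar x := by
  rintro rfl
  exact h (pbar_pbar x).symm

theorem nf_pos {n l p : ℕ} (h : l < n) (hp : 0 < p) : l < n * p :=
  lt_of_lt_of_le h (Nat.le_mul_of_pos_right n hp)

theorem nfw_cyc {S : Type*} {s : ℤ → S × Bool} {n : ℕ} {i j : ℤ} {l p q : ℕ}
    (per : ∀ t, s (t + n) = s t) (red : ∀ t, s (t + 1) ≠ pbar (s t)) (h : NF s n i j l)
    (hp : 0 < p) (hq : 0 < q) : FreeGroup.IsCyclicallyReduced (nfw s n i j l p q) := by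
  have h1 := nf_pos h.lt hp
  have h2 := nf_pos h.lt hq
  have l1 := win_last s (i + l) (n * p - l) (by omega)
  have l2 := win_last s j (n * q - l) (by omega)
  have d1 := win_head s (i + l) (n * p - l) (by omega)
  have d2 := win_head s j (n * q - l) (by omega)
  rw [cyc_iff, nfw, List.isChain_append, l1, d2]
  refine ⟨⟨win_chain red _ _, win_chain red _ _, ?_⟩, ?_⟩
  · intro x hx y hy
    simp only [Option.mem_def, Option.some.injEq] at hx hy
    subst hx hy
    have e : s (i + l + ((n * p - l : ℕ) : ℤ) - 1) = s (i - 1) :=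
      per_dvd per ⟨p, by push_cast [Nat.cast_sub h1.le]; ring⟩
    rw [e]
    exact ne_pbar_symm h.b
  · intro x hx y hy
    rw [List.getLast?_append, l2] at hx
    rw [List.head?_append, d1] at hy
    simp only [Option.mem_def, Option.some.injEq, Option.some_or] at hx hy
    subst hx hy
    have e : s (j + ((n * q - l : ℕ) : ℤ) - 1) = s (j - 1 - l) :=
      per_dvd per ⟨q, by push_cast [Nat.cast_sub h2.le]; ring⟩
    rw [e]
    exact h.c

theorem invRev_win {S : Type*} (s : ℤ → S × Bool) (i j : ℤ) (l : ℕ)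
    (ov : ∀ t : ℕ, t < l → s (i + t) = pbar (s (j - 1 - t))) :
    FreeGroup.invRev (win s i l) = win s (j - l) l := by
  apply List.ext_getElem
  · simp [FreeGroup.invRev, win]
  · intro t h1 h2
    rw [win_length] at h2
    simp only [FreeGroup.invRev, List.getElem_reverse, List.getElem_map, win_getElem, List.length_map,
      win_length]
    rw [ov _ (by omega)]
    rw [show ∀ x : S × Bool, ((pbar x).1, !(pbar x).2) = x from fun x => pbar_pbar x]
    congr 1
    omega

theorem nfw_conj {S : Type*} {s : ℤ → S × Bool} {n : ℕ} {i j : ℤ} {l p q : ℕ}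
    (per : ∀ t, s (t + n) = s t) (h : NF s n i j l)
    (hp : 0 < p) (hq : 0 < q) :
    IsConj (FreeGroup.mk (win s i (n * p) ++ win s j (n * q))) (FreeGroup.mk (nfw s n i j l p q)) := by
  have h1 := nf_pos h.lt hp
  have h2 := nf_pos h.lt hq
  have e1 : win s i (n * p) = win s i l ++ win s (i + l) (n * p - l) := by
    rw [← win_add]; congr 1; omega
  have e2 : win s j (n * q) = win s j (n * q - l) ++ win s (j - l) l := by
    have := win_add s j (n * q - l) l
    rw [Nat.sub_add_cancel h2.le] at this
    rw [this]
    congr 1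
    exact win_congr per l ⟨q, by push_cast [Nat.cast_sub h2.le]; ring⟩
  rw [e1, e2, ← invRev_win s i j l h.ov, nfw, ← FreeGroup.mul_mk, ← FreeGroup.mul_mk,
    ← FreeGroup.mul_mk, ← FreeGroup.mul_mk, ← FreeGroup.inv_mk]
  rw [isConj_iff]
  exact ⟨(FreeGroup.mk (win s i l))⁻¹, by group⟩

/-- The letters of the normal form word. -/
def nfl {S : Type*} (s : ℤ → S × Bool) (n : ℕ) (i j : ℤ) (l p : ℕ) (t : ℕ) : S × Bool :=
  if t < n * p - l then s (i + l + t) else s (j + (t - (n * p - l) : ℕ))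

theorem nfw_length {S : Type*} (s : ℤ → S × Bool) (n : ℕ) (i j : ℤ) (l p q : ℕ) :
    (nfw s n i j l p q).length = (n * p - l) + (n * q - l) := by
  simp [nfw, win_length]

theorem nfw_getElem {S : Type*} (s : ℤ → S × Bool) (n : ℕ) (i j : ℤ) (l p q t : ℕ)
    (h : t < (nfw s n i j l p q).length) : (nfw s n i j l p q)[t] = nfl s n i j l p t := by
  unfold nfl
  simp only [nfw, List.getElem_append, win_getElem, win_length]
  split <;> rfl

theorem rot_letters {S : Type*} {s : ℤ → S × Bool} {n : ℕ} {i j k h : ℤ} {l l' p q : ℕ}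
    (hl : l < n) (hl' : l' < n) (hp : 0 < p) (hq : 0 < q)
    (hr : nfw s n i j l p q ~r nfw s n k h l' p q) :
    l = l' ∧ ∃ r < (n * p - l) + (n * q - l), ∀ t < (n * p - l) + (n * q - l),
      nfl s n k h l p t = nfl s n i j l p ((t + r) % ((n * p - l) + (n * q - l))) := by
  have h1 := nf_pos hl hp
  have h2 := nf_pos hl hq
  have h3 := nf_pos hl' hp
  have h4 := nf_pos hl' hq
  have hlen := hr.perm.length_eq
  rw [nfw_length, nfw_length] at hlen
  have : l = l' := by omega
  subst this
  refine ⟨rfl, ?_⟩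
  obtain ⟨r, hr⟩ := hr
  rw [← List.rotate_mod, nfw_length] at hr
  refine ⟨_, Nat.mod_lt r (by omega), ?_⟩
  intro t ht
  have ht' : t < (nfw s n k h l p q).length := by rwa [nfw_length]
  rw [← nfw_getElem s n k h l p q t ht']
  rw [← nfw_getElem s n i j l p q _ (by rw [nfw_length]; exact Nat.mod_lt _ (by omega))]
  simp only [← hr, List.getElem_rotate, nfw_length]

/-! ### Comparing two normal forms -/

theorem nfl_lt {S : Type*} (s : ℤ → S × Bool) (n : ℕ) (i j : ℤ) (l p : ℕ) (t : ℕ)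
    (h : t < n * p - l) : nfl s n i j l p t = s (i + l + t) := if_pos h

theorem nfl_ge {S : Type*} (s : ℤ → S × Bool) (n : ℕ) (i j : ℤ) (l p : ℕ) (t : ℕ)
    (h : n * p - l ≤ t) : nfl s n i j l p t = s (j + (t - (n * p - l) : ℕ)) :=
  if_neg (not_lt.2 h)

theorem nfl_last {S : Type*} {s : ℤ → S × Bool} {n : ℕ} (per : ∀ t, s (t + n) = s t)
    (i j : ℤ) {l p q : ℕ} (hl : l < n) (hp : 0 < p) (hq : 0 < q) :
    nfl s n i j l p ((n * p - l) + (n * q - l) - 1) = s (j - l - 1) := by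
  have h1 := nf_pos hl hp
  have h2 := nf_pos hl hq
  rw [nfl_ge _ _ _ _ _ _ _ (by omega)]
  apply per_dvd per
  refine ⟨q, ?_⟩
  have : ((n * p - l) + (n * q - l) - 1 - (n * p - l) : ℕ) = n * q - (l + 1) := by omega
  rw [this, Nat.cast_sub (by omega)]
  push_cast
  ring

theorem short_rot {S : Type*} {s : ℤ → S × Bool} {n : ℕ} (per : ∀ t, s (t + n) = s t)
    {i j k h : ℤ} {l p q r : ℕ} (hl : l < n) (hp : 0 < p) (hq : 0 < q)
    (hr0 : 0 < r) (hr : r + n ≤ n * p - l)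
    (hG : ∀ t < (n * p - l) + (n * q - l),
      nfl s n k h l p t = nfl s n i j l p ((t + r) % ((n * p - l) + (n * q - l))))
    (d : s (k + l - 1) ≠ s (h - l - 1)) : False := by
  have h1 := nf_pos hl hp
  have h2 := nf_pos hl hq
  have g1 := hG ((n * p - l) + (n * q - l) - 1) (by omega)
  have g2 := hG (n - 1) (by omega)
  rw [nfl_last per k h hl hp hq] at g1
  rw [show (n * p - l) + (n * q - l) - 1 + r = (r - 1) + ((n * p - l) + (n * q - l)) by omega,
    Nat.add_mod_right, Nat.mod_eq_of_lt (by omega), nfl_lt _ _ _ _ _ _ _ (by omega)] at g1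
  rw [Nat.mod_eq_of_lt (by omega), nfl_lt _ _ _ _ _ _ _ (by omega),
    nfl_lt _ _ _ _ _ _ _ (by omega)] at g2
  apply d
  rw [g1]
  have e1 : s (k + l - 1) = s (k + l + ((n - 1 : ℕ) : ℤ)) :=
    per_dvd per ⟨-1, by push_cast [Nat.cast_sub (show 1 ≤ n by omega)]; ring⟩
  rw [e1, g2]
  apply per_dvd per
  refine ⟨1, ?_⟩
  push_cast [Nat.cast_sub (show 1 ≤ n by omega), Nat.cast_sub (show 1 ≤ r by omega)]
  ring

theorem eq_of_window {β : Type*} {s : ℤ → β} {n : ℕ} (hn : 0 < n) (per : ∀ t, s (t + n) = s t)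
    (prim : ∀ d : ℤ, (∀ t, s (t + d) = s t) → (n : ℤ) ∣ d) {a b : ℤ}
    (h : ∀ t : ℕ, t < n → s (a + t) = s (b + t)) : (n : ℤ) ∣ a - b := by
  apply prim
  intro t
  have hn' : (n : ℤ) ≠ 0 := by exact_mod_cast hn.ne'
  have h0 := Int.emod_nonneg (t - b) hn'
  have h1 := Int.emod_lt_of_pos (t - b) (show (0 : ℤ) < n by exact_mod_cast hn)
  have h2 := Int.emod_add_mul_ediv (t - b) n
  have := h ((t - b) % n).toNat (by omega)
  rw [Int.toNat_of_nonneg h0] at this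
  rw [per_dvd per (u := a + (t - b) % n) ⟨(t - b) / n, by linarith⟩, this]
  exact per_dvd per ⟨-((t - b) / n), by linarith⟩

theorem core {S : Type*} {s : ℤ → S × Bool} {n : ℕ} (hn : 0 < n) (per : ∀ t, s (t + n) = s t)
    (red : ∀ t, s (t + 1) ≠ pbar (s t))
    (prim : ∀ d : ℤ, (∀ t, s (t + d) = s t) → (n : ℤ) ∣ d)
    {i j k h : ℤ} {l l' p q : ℕ} (N : NF s n i j l) (N' : NF s n k h l')
    (hp : 3 ≤ p) (hq : 0 < q) (hqp : q < p)
    (d : s (i + l - 1) ≠ s (j - l - 1)) (d' : s (k + l' - 1) ≠ s (h - l' - 1))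
    (hr : nfw s n i j l p q ~r nfw s n k h l' p q) : (n : ℤ) ∣ i - k ∧ (n : ℤ) ∣ j - h := by
  obtain ⟨rfl, r, hrL, hG⟩ := rot_letters N.lt N'.lt (by omega) hq hr
  have hl := N.lt
  have h1 := nf_pos hl (show 0 < p by omega)
  have h2 := nf_pos hl hq
  have hM3 : n * 3 ≤ n * p := Nat.mul_le_mul_left n hp
  have hMq : n * q + n ≤ n * p := by
    have := Nat.mul_le_mul_left n (show q + 1 ≤ p by omega)
    rwa [mul_add, mul_one] at this
  have hr0 : r = 0 := by
    by_contra hr0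
    by_cases c1 : r + n ≤ n * p - l
    · exact short_rot per hl (by omega) hq (by omega) c1 hG d'
    by_cases c2 : ((n * p - l) + (n * q - l) - r) + n ≤ n * p - l
    · refine short_rot (i := k) (j := h) (k := i) (h := j) per hl (by omega) hq
        (r := (n * p - l) + (n * q - l) - r) (by omega) c2 ?_ d
      intro t ht
      rw [hG _ (Nat.mod_lt _ (by omega))]
      congr 1
      rw [Nat.mod_add_mod, show t + ((n * p - l) + (n * q - l) - r) + r
        = t + ((n * p - l) + (n * q - l)) by omega, Nat.add_mod_right, Nat.mod_eq_of_lt ht]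
    have hq2 : 2 ≤ q := by
      by_contra hq2
      have : q = 1 := by omega
      subst this
      omega
    have hMq2 : n * 2 ≤ n * q := Nat.mul_le_mul_left n hq2
    have g1 := hG (n * p - l - 1 - r) (by omega)
    have g2 := hG (n * p - l - 1 - r + n) (by omega)
    rw [nfl_lt _ _ _ _ _ _ _ (by omega), Nat.mod_eq_of_lt (by omega),
      nfl_lt _ _ _ _ _ _ _ (by omega)] at g1
    rw [nfl_lt _ _ _ _ _ _ _ (by omega), Nat.mod_eq_of_lt (by omega),
      nfl_ge _ _ _ _ _ _ _ (by omega)] at g2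
    have e1 : s (i - 1) = s (j - 1) := by
      have a1 : s (i - 1) = s (i + l + ((n * p - l - 1 - r + r : ℕ) : ℤ)) := by
        refine per_dvd per ⟨-p, ?_⟩
        rw [show n * p - l - 1 - r + r = n * p - (l + 1) by omega, Nat.cast_sub (by omega)]
        push_cast; ring
      have a2 : s (j - 1) = s (j + ((n * p - l - 1 - r + n + r - (n * p - l) : ℕ) : ℤ)) := by
        refine per_dvd per ⟨-1, ?_⟩
        rw [show n * p - l - 1 - r + n + r - (n * p - l) = n - 1 by omega, Nat.cast_sub (by omega)]
        push_cast; ring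
      rw [a1, a2, ← g1, ← g2]
      exact per_dvd per ⟨-1, by push_cast; ring⟩
    rcases Nat.eq_zero_or_pos l with rfl | hlp
    · apply d
      simpa using e1
    · have o := N.ov 0 hlp
      simp only [Nat.cast_zero, add_zero, sub_zero] at o
      have := red (i - 1)
      rw [sub_add_cancel, e1] at this
      exact this o
  subst hr0
  have hik : (n : ℤ) ∣ (i + l) - (k + l) := by
    apply eq_of_window hn per prim
    intro t ht
    have := hG t (by omega)
    rw [add_zero, Nat.mod_eq_of_lt (by omega), nfl_lt _ _ _ _ _ _ _ (by omega),
      nfl_lt _ _ _ _ _ _ _ (by omega)] at this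
    exact this.symm
  have hik' : (n : ℤ) ∣ i - k := by simpa using hik
  refine ⟨hik', ?_⟩
  have hjh : (n : ℤ) ∣ (j - l) - (h - l) := by
    apply eq_of_window hn per prim
    intro t ht
    have hnq : n ≤ n * q := Nat.le_mul_of_pos_right n hq
    by_cases htl : t < l
    · have o1 := N.ov (l - 1 - t) (by omega)
      have o2 := N'.ov (l - 1 - t) (by omega)
      have e : s (i + ((l - 1 - t : ℕ) : ℤ)) = s (k + ((l - 1 - t : ℕ) : ℤ)) :=
        per_dvd per (by simpa using hik')
      rw [e, o2] at o1
      have o3 := congrArg pbar o1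
      rw [pbar_pbar, pbar_pbar] at o3
      convert o3.symm using 2 <;> omega
    · have := hG (n * p - l + (t - l)) (by omega)
      rw [add_zero, Nat.mod_eq_of_lt (by omega), nfl_ge _ _ _ _ _ _ _ (by omega),
        nfl_ge _ _ _ _ _ _ _ (by omega)] at this
      convert this.symm using 2 <;> omega
  simpa using hjh

theorem core_diag {S : Type*} {s : ℤ → S × Bool} {n : ℕ} (hn : 0 < n)
    (per : ∀ t, s (t + n) = s t) {i k h : ℤ} {l' p q : ℕ} (N : NF s n i i 0) (N' : NF s n k h l')
    (hp : 0 < p) (hq : 0 < q) (d' : s (k + l' - 1) ≠ s (h - l' - 1))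
    (hr : nfw s n i i 0 p q ~r nfw s n k h l' p q) : False := by
  obtain ⟨rfl, r, hrL, hG⟩ := rot_letters N.lt N'.lt hp hq hr
  have h1 := nf_pos hn hp
  have h2 := nf_pos hn hq
  have hnp : n ≤ n * p := Nat.le_mul_of_pos_right n hp
  have key : ∀ t, nfl s n i i 0 p t = s (i + t) := by
    intro t
    by_cases ht : t < n * p - 0
    · rw [nfl_lt _ _ _ _ _ _ _ ht]; simp
    · rw [nfl_ge _ _ _ _ _ _ _ (by omega)]
      refine per_dvd per ⟨-p, ?_⟩
      rw [Nat.cast_sub (by omega), Nat.sub_zero]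
      push_cast; ring
  have key2 : ∀ t : ℕ, s (i + (t % (n * p - 0 + (n * q - 0)) : ℕ)) = s (i + t) := by
    intro t
    refine per_dvd per ⟨-((p + q) * (t / (n * p - 0 + (n * q - 0)) : ℕ)), ?_⟩
    have := Nat.mod_add_div t (n * p - 0 + (n * q - 0))
    have e : (t : ℤ) = (t % (n * p - 0 + (n * q - 0)) : ℕ) +
      (n * p + n * q) * (t / (n * p - 0 + (n * q - 0)) : ℕ) := by
      conv_lhs => rw [← this]
      push_cast; simp
    rw [e]; simp; ring
  have g1 := hG ((n * p - 0) + (n * q - 0) - 1) (by omega)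
  have g2 := hG (n - 1) (by omega)
  rw [nfl_last per k h hn hp hq, key, key2] at g1
  rw [nfl_lt _ _ _ _ _ _ _ (by omega), key, key2] at g2
  apply d'
  rw [g1, per_dvd per (t := k + (0 : ℕ) - 1) (u := k + (0 : ℕ) + ((n - 1 : ℕ) : ℤ))
    ⟨-1, by push_cast [Nat.cast_sub (show 1 ≤ n by omega)]; ring⟩, g2]
  refine per_dvd per ⟨1 - p - q, ?_⟩
  rw [show n * p - 0 + (n * q - 0) - 1 = n * p + n * q - 1 by omega]
  push_cast [Nat.cast_sub (show 1 ≤ n by omega), Nat.cast_sub (show 1 ≤ n * p + n * q by omega)]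
  ring

/-! ### Existence of normal forms -/

theorem exists_not_reflect {S : Type*} {s : ℤ → S × Bool} {n : ℕ} (hn : 0 < n)
    (per : ∀ t, s (t + n) = s t) (red : ∀ t, s (t + 1) ≠ pbar (s t)) (a b : ℤ) :
    ∃ t : ℕ, t < n ∧ s (a + t) ≠ pbar (s (b - t)) := by
  by_contra hcon
  push Not at hcon
  have all : ∀ t : ℤ, s (a + t) = pbar (s (b - t)) := by
    intro t
    have hn' : (n : ℤ) ≠ 0 := by exact_mod_cast hn.ne'
    have h0 := Int.emod_nonneg t hn'
    have h1 := Int.emod_lt_of_pos t (show (0 : ℤ) < n by exact_mod_cast hn)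
    have h2 := Int.emod_add_mul_ediv t n
    have := hcon (t % n).toNat (by omega)
    rw [Int.toNat_of_nonneg h0] at this
    rw [per_dvd per (t := a + t) (u := a + t % n) ⟨t / n, by linarith⟩, this]
    congr 1
    exact per_dvd per ⟨t / n, by linarith⟩
  rcases Int.even_or_odd' (b - a) with ⟨c, hc | hc⟩
  · have := all c
    rw [show b - c = a + c by linarith] at this
    exact pbar_ne _ this.symm
  · have := all (c + 1)
    rw [show b - (c + 1) = a + c by linarith, ← add_assoc] at this
    exact red _ this

theorem exists_NF {S : Type*} {s : ℤ → S × Bool} {n : ℕ} (hn : 0 < n)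
    (per : ∀ t, s (t + n) = s t) (red : ∀ t, s (t + 1) ≠ pbar (s t))
    (prim : ∀ d : ℤ, (∀ t, s (t + d) = s t) → (n : ℤ) ∣ d)
    (R : ℤ → ℤ → ℤ → ℤ → Prop) (Rrefl : ∀ i j, R i j i j)
    (Rtrans : ∀ a b c d e f, R a b c d → R c d e f → R a b e f)
    (R1 : ∀ i j, s (i - 1) = s (j - 1) → R i j (i - 1) (j - 1))
    (R2 : ∀ i j, s (i - 1) = pbar (s j) → R i j (i - 1) (j + 1))
    (i j : ℤ) (hij : ¬ (n : ℤ) ∣ i - j) :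
    ∃ i' j' l, R i j i' j' ∧ NF s n i' j' l ∧ s (i' + l - 1) ≠ s (j' - l - 1) := by
  classical
  -- first move
  obtain ⟨i1, j1, hR1, hb, hij1⟩ : ∃ i' j', R i j i' j' ∧ s (i' - 1) ≠ pbar (s j') ∧
      ¬ (n : ℤ) ∣ i' - j' := by
    have hex : ∃ t : ℕ, s (i - 1 - t) ≠ pbar (s (j + t)) := by
      obtain ⟨t, _, ht⟩ := exists_not_reflect hn per red j (i - 1)
      exact ⟨t, ne_pbar_symm ht⟩
    have hstep : ∀ t : ℕ, t ≤ Nat.find hex → R i j (i - t) (j + t) := by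
      intro t
      induction t with
      | zero => intro _; simpa using Rrefl i j
      | succ t ih =>
        intro ht
        have h1 := Nat.find_min hex (m := t) (by omega)
        rw [not_not] at h1
        have h2 := R2 (i - t) (j + t) (by rw [← h1]; congr 1; ring)
        have := Rtrans _ _ _ _ _ _ (ih (by omega)) h2
        convert this using 1 <;> push_cast <;> ring
    refine ⟨_, _, hstep _ le_rfl, ?_, ?_⟩
    · have := Nat.find_spec hex
      rwa [show ∀ x : ℤ, i - x - 1 = i - 1 - x from fun x => by ring]
    · intro hd
      rcases Nat.eq_zero_or_pos (Nat.find hex) with h0 | hpos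
      · rw [h0] at hd
        exact hij (by simpa using hd)
      · have h1 := Nat.find_min hex (m := Nat.find hex - 1) (by omega)
        rw [not_not, Nat.cast_sub (by omega)] at h1
        have h2 := per_dvd per hd
        have h3 := red (j + Nat.find hex - 1)
        rw [sub_add_cancel, ← h2] at h3
        apply h3
        convert h1 using 2
        · push_cast; ring
        · congr 1; push_cast; ring
  -- overlap
  have hex : ∃ t : ℕ, s (i1 + t) ≠ pbar (s (j1 - 1 - t)) := by
    obtain ⟨t, _, ht⟩ := exists_not_reflect hn per red i1 (j1 - 1)
    exact ⟨t, ht⟩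
  have hlt : Nat.find hex < n := by
    obtain ⟨t, h, ht⟩ := exists_not_reflect hn per red i1 (j1 - 1)
    exact lt_of_le_of_lt (Nat.find_min' hex ht) h
  have hov : ∀ t < Nat.find hex, s (i1 + t) = pbar (s (j1 - 1 - t)) := by
    intro t ht
    simpa using Nat.find_min hex ht
  have hc := Nat.find_spec hex
  rcases Nat.eq_zero_or_pos (Nat.find hex) with h0 | hpos
  · rw [h0] at hc
    simp only [Nat.cast_zero, add_zero, sub_zero] at hc
    have hex2 : ∃ u : ℕ, s (i1 - 1 - u) ≠ s (j1 - 1 - u) := by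
      by_contra hcon
      push Not at hcon
      apply hij1
      have : (n : ℤ) ∣ (i1 - n) - (j1 - n) := by
        apply eq_of_window hn per prim
        intro t ht
        have := hcon (n - 1 - t)
        convert this using 2 <;> omega
      simpa using this
    have hstep : ∀ t : ℕ, t ≤ Nat.find hex2 → R i j (i1 - t) (j1 - t) := by
      intro t
      induction t with
      | zero => intro _; simpa using hR1
      | succ t ih =>
        intro ht
        have h1 := Nat.find_min hex2 (m := t) (by omega)
        rw [not_not] at h1
        have h2 := R1 (i1 - t) (j1 - t) (by convert h1 using 2 <;> ring)
        have := Rtrans _ _ _ _ _ _ (ih (by omega)) h2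
        convert this using 1 <;> push_cast <;> ring
    have hd : s (i1 - Nat.find hex2 - 1) ≠ s (j1 - Nat.find hex2 - 1) := by
      have := Nat.find_spec hex2
      convert this using 2 <;> ring
    refine ⟨_, _, 0, hstep _ le_rfl, ?_, by simpa using hd⟩
    rcases Nat.eq_zero_or_pos (Nat.find hex2) with h0 | hpos
    · rw [h0]
      exact ⟨hn, fun t ht => absurd ht (by omega), by simpa using hb, by simpa using hc⟩
    · have h1 := Nat.find_min hex2 (m := Nat.find hex2 - 1) (by omega)
      rw [not_not, Nat.cast_sub (by omega)] at h1
      have h2 : s (i1 - Nat.find hex2) = s (j1 - Nat.find hex2) := by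
        convert h1 using 2 <;> push_cast <;> ring
      refine ⟨hn, fun t ht => absurd ht (by omega), ?_, ?_⟩
      · rw [← h2]
        have := red (i1 - Nat.find hex2 - 1)
        rw [sub_add_cancel] at this
        exact ne_pbar_symm this
      · have := red (j1 - Nat.find hex2 - 1)
        rw [sub_add_cancel] at this
        simpa [h2] using this
  · refine ⟨i1, j1, Nat.find hex, hR1, ⟨hlt, hov, hb, hc⟩, ?_⟩
    have h1 := hov (Nat.find hex - 1) (by omega)
    rw [Nat.cast_sub (by omega)] at h1
    intro heq
    have h2 := red (j1 - Nat.find hex - 1)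
    rw [← heq] at h2
    apply ne_pbar_symm h2
    convert h1 using 2
    · push_cast; ring
    · congr 1; push_cast; ring

/-! ### The periodic sequence of a word -/

section Word

variable {S : Type*} [Inhabited S]

/-- The bi-infinite periodic sequence attached to the word `X`. -/
def sq (X : List (S × Bool)) (t : ℤ) : S × Bool := letterZ X (t : ZMod X.length)

theorem sq_per (X : List (S × Bool)) (t : ℤ) : sq X (t + X.length) = sq X t := by
  simp [sq]

theorem sq_eq (X : List (S × Bool)) (hX : X ≠ []) (m : ℕ) (hm : m < X.length) :
    sq X m = X.getD m default := by
  have : NeZero X.length := ⟨by simpa using hX⟩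
  simp only [sq, letterZ, Int.cast_natCast]
  rw [ZMod.val_natCast, Nat.mod_eq_of_lt hm]

theorem win_sq (X : List (S × Bool)) (hX : X ≠ []) : win (sq X) 0 X.length = X := by
  apply List.ext_getElem
  · rw [win_length]
  · intro t h1 h2
    rw [win_getElem, zero_add, sq_eq X hX t h2]
    simp [h2]

theorem rotZ_eq (X : List (S × Bool)) (hX : X ≠ []) (a : ℤ) :
    rotZ X (a : ZMod X.length) = win (sq X) a X.length := by
  have hn : NeZero X.length := ⟨by simpa using hX⟩
  apply List.ext_getElem
  · rw [win_length, rotZ, List.length_rotate]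
  · intro t h1 h2
    rw [win_getElem]
    simp only [rotZ, List.getElem_rotate]
    have hlt : (t + (a : ZMod X.length).val) % X.length < X.length :=
      Nat.mod_lt _ (List.length_pos_iff.2 hX)
    have := sq_eq X hX _ hlt
    rw [List.getD_eq_getElem _ _ hlt] at this
    rw [← this]
    simp only [sq]
    congr 1
    push_cast
    rw [ZMod.natCast_zmod_val]
    ring

theorem sq_red (X : List (S × Bool)) (hX : CyclicallyReduced pbar X) (t : ℤ) :
    sq X (t + 1) ≠ pbar (sq X t) := by
  obtain ⟨h0, h1, h2⟩ := hX
  have hn : 0 < X.length := List.length_pos_iff.2 h0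
  have hn' : (X.length : ℤ) ≠ 0 := by exact_mod_cast hn.ne'
  have e0 := Int.emod_nonneg t hn'
  have e1 := Int.emod_lt_of_pos t (show (0 : ℤ) < X.length by exact_mod_cast hn)
  have e2 := Int.emod_add_mul_ediv t X.length
  obtain ⟨m, hm⟩ := Int.eq_ofNat_of_zero_le e0
  rw [hm] at e1 e2
  have hm1 : m < X.length := by exact_mod_cast e1
  rw [per_dvd (sq_per X) (t := t) (u := m) ⟨t / X.length, by linarith⟩, sq_eq X h0 m hm1]
  by_cases hlt : m + 1 < X.length
  · rw [per_dvd (sq_per X) (t := t + 1) (u := (m + 1 : ℕ)) ⟨t / X.length, by push_cast; linarith⟩,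
      sq_eq X h0 _ hlt]
    exact h1 m hlt
  · have hm2 : m = X.length - 1 := by omega
    have hm3 : (m : ℤ) + 1 = X.length := by omega
    rw [per_dvd (sq_per X) (t := t + 1) (u := (0 : ℕ))
      ⟨t / X.length + 1, by push_cast; linarith⟩, sq_eq X h0 _ hn, hm2]
    exact h2

theorem sq_prim (X : List (S × Bool)) (h0 : X ≠ []) (hX : Primitive X) (d : ℤ)
    (hd : ∀ t, sq X (t + d) = sq X t) : (X.length : ℤ) ∣ d := by
  have hn : 0 < X.length := List.length_pos_iff.2 h0
  by_contra hnd
  apply hX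
  have hg : ∀ t, sq X (t + (Int.gcd X.length d : ℕ)) = sq X t := by
    intro t
    rw [Int.gcd_eq_gcd_ab, ← add_assoc, per_mul hd, per_mul (sq_per X)]
  have hgd : Int.gcd X.length d ∣ X.length := by
    exact_mod_cast Int.gcd_dvd_left (X.length : ℤ) d
  obtain ⟨r, hr⟩ := hgd
  refine ⟨win (sq X) 0 (Int.gcd X.length d), r, ?_, ?_⟩
  · by_contra hlt
    have : r = 0 ∨ r = 1 := by omega
    rcases this with rfl | rfl
    · omega
    · rw [mul_one] at hr
      apply hnd
      have := Int.gcd_dvd_right (X.length : ℤ) d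
      rwa [← hr] at this
  · rw [← win_mul hg, ← hr, win_sq X h0]

theorem mk_wpow (V : List (S × Bool)) (p : ℕ) :
    FreeGroup.mk (wpow V p) = FreeGroup.mk V ^ p := by
  rw [FreeGroup.pow_mk]; rfl

theorem elt_succ (X : List (S × Bool)) (h0 : X ≠ []) (a : ZMod X.length) :
    FreeGroup.mk (rotZ X (a + 1)) =
      (FreeGroup.mk [letterZ X a])⁻¹ * FreeGroup.mk (rotZ X a) * FreeGroup.mk [letterZ X a] := by
  obtain ⟨b, rfl⟩ := ZMod.intCast_surjective a
  have hn : 0 < X.length := List.length_pos_iff.2 h0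
  have e1 : rotZ X ((b : ZMod X.length) + 1) = win (sq X) (b + 1) X.length := by
    rw [← rotZ_eq X h0]; simp
  have e2 : win (sq X) (b + 1) X.length = win (sq X) (b + 1) (X.length - 1) ++ [sq X b] := by
    have := win_add (sq X) (b + 1) (X.length - 1) 1
    rw [Nat.sub_add_cancel hn] at this
    rw [this]
    congr 1
    simp only [win, List.range_one, List.map_cons, List.map_nil]
    congr 1
    exact per_dvd (sq_per X) ⟨1, by push_cast [Nat.cast_sub (show 1 ≤ X.length from hn)]; ring⟩
  have e3 : win (sq X) b X.length = [sq X b] ++ win (sq X) (b + 1) (X.length - 1) := by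
    have := win_add (sq X) b 1 (X.length - 1)
    rw [Nat.add_sub_cancel' hn] at this
    rw [this]
    simp [win]
  rw [e1, rotZ_eq X h0, e2, e3, ← FreeGroup.mul_mk, ← FreeGroup.mul_mk]
  change _ = (FreeGroup.mk [sq X b])⁻¹ * _ * FreeGroup.mk [sq X b]
  group

theorem conj_of_REq (X : List (S × Bool)) (h0 : X ≠ []) (p q : ℕ)
    (a b : ZMod X.length × ZMod X.length) (h : REq pbar X X a b) :
    IsConj (FreeGroup.mk (wpow (rotZ X a.1) p ++ wpow (rotZ X a.2) q))
        (FreeGroup.mk (wpow (rotZ X b.1) p ++ wpow (rotZ X b.2) q)) := by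
  induction h with
  | refl => exact IsConj.refl _
  | symm _ _ _ ih => exact ih.symm
  | trans _ _ _ _ _ ih1 ih2 => exact ih1.trans ih2
  | rel a b hab =>
    obtain ⟨a1, a2⟩ := a
    simp only [← FreeGroup.mul_mk, mk_wpow]
    rcases hab with ⟨rfl, hl⟩ | ⟨rfl, hl⟩
    · simp only at hl ⊢
      rw [elt_succ X h0, elt_succ X h0, ← hl, isConj_iff]
      refine ⟨(FreeGroup.mk [letterZ X a1])⁻¹, ?_⟩
      have key : ∀ (g : FreeGroup S) (x : FreeGroup S) (m : ℕ),
          (g⁻¹ * x * g) ^ m = g⁻¹ * x ^ m * g := by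
        intro g x m
        have := conj_pow (i := m) (a := g⁻¹) (b := x)
        simpa using this
      rw [key, key]
      group
    · simp only at hl ⊢
      have h1 := elt_succ X h0 (a1 - 1)
      rw [sub_add_cancel, hl, mk_pbar] at h1
      rw [elt_succ X h0 a2, h1, isConj_iff]
      refine ⟨(FreeGroup.mk [letterZ X a2])⁻¹, ?_⟩
      have key : ∀ (g : FreeGroup S) (x : FreeGroup S) (m : ℕ),
          (g⁻¹ * x * g) ^ m = g⁻¹ * x ^ m * g := by
        intro g x m
        have := conj_pow (i := m) (a := g⁻¹) (b := x)
        simpa using this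
      rw [key, key]
      group

theorem REq_swap (X : List (S × Bool)) (a b : ZMod X.length × ZMod X.length)
    (h : REq pbar X X a b) : REq pbar X X a.swap b.swap := by
  induction h with
  | refl => exact Relation.EqvGen.refl _
  | symm _ _ _ ih => exact Relation.EqvGen.symm _ _ ih
  | trans _ _ _ _ _ ih1 ih2 => exact Relation.EqvGen.trans _ _ _ ih1 ih2
  | rel a b hab =>
    obtain ⟨a1, a2⟩ := a
    rcases hab with ⟨rfl, hl⟩ | ⟨rfl, hl⟩
    · exact Relation.EqvGen.rel _ _ (Or.inl ⟨rfl, hl.symm⟩)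
    · refine Relation.EqvGen.symm _ _ (Relation.EqvGen.rel _ _ (Or.inr ⟨?_, ?_⟩))
      · simp
      · simp only [Prod.swap_prod_mk, add_sub_cancel_right] at hl ⊢
        rw [hl, pbar_pbar]

theorem REq_diag (X : List (S × Bool)) (a b : ℤ) :
    REq pbar X X ((a : ZMod X.length), (a : ZMod X.length)) (b, b) := by
  have h1 : ∀ (c : ℤ) (m : ℕ), REq pbar X X ((c : ZMod X.length), (c : ZMod X.length))
      ((c + m : ℤ), (c + m : ℤ)) := by
    intro c m
    induction m with
    | zero => simpa [REq] using Relation.EqvGen.refl _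
    | succ m ih =>
      refine Relation.EqvGen.trans _ _ _ ih (Relation.EqvGen.rel _ _ (Or.inl ⟨?_, rfl⟩))
      push_cast
      simp [add_assoc]
  rcases le_total a b with h | h
  · have := h1 a (b - a).toNat
    rwa [Int.toNat_of_nonneg (by omega), add_sub_cancel] at this
  · have := h1 b (a - b).toNat
    rw [Int.toNat_of_nonneg (by omega), add_sub_cancel] at this
    exact Relation.EqvGen.symm _ _ this

theorem main_aux (X : List (S × Bool)) (hX : CyclicallyReduced pbar X) (hprim : Primitive X)
    (i j k h : ZMod X.length) (p q : ℕ) (hp : 3 ≤ p) (hq : 0 < q) (hqp : q < p)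
    (hc : IsConj (FreeGroup.mk (wpow (rotZ X i) p ++ wpow (rotZ X j) q))
        (FreeGroup.mk (wpow (rotZ X k) p ++ wpow (rotZ X h) q))) :
    REq pbar X X (i, j) (k, h) := by
  have h0 : X ≠ [] := hX.1
  have hn : 0 < X.length := List.length_pos_iff.2 h0
  have per := sq_per X
  have red := sq_red X hX
  have prim := sq_prim X h0 hprim
  have hp0 : 0 < p := by omega
  obtain ⟨i, rfl⟩ := ZMod.intCast_surjective i
  obtain ⟨j, rfl⟩ := ZMod.intCast_surjective j
  obtain ⟨k, rfl⟩ := ZMod.intCast_surjective k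
  obtain ⟨h, rfl⟩ := ZMod.intCast_surjective h
  have hcast : ∀ a b : ℤ, (X.length : ℤ) ∣ a - b → (a : ZMod X.length) = b := by
    intro a b hab
    rw [← sub_eq_zero, ← Int.cast_sub]
    exact (ZMod.intCast_zmod_eq_zero_iff_dvd _ _).2 hab
  have hmk : ∀ a b : ℤ, FreeGroup.mk (wpow (rotZ X (a : ZMod X.length)) p ++
      wpow (rotZ X (b : ZMod X.length)) q) =
      FreeGroup.mk (win (sq X) a (X.length * p) ++ win (sq X) b (X.length * q)) := by
    intro a b
    rw [rotZ_eq X h0, rotZ_eq X h0, win_mul per, win_mul per]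
  have hNF : ∀ a b : ℤ, ¬ (X.length : ℤ) ∣ a - b → ∃ a' b' l,
      REq pbar X X ((a : ZMod X.length), (b : ZMod X.length)) ((a' : ℤ), (b' : ℤ)) ∧
      NF (sq X) X.length a' b' l ∧ sq X (a' + l - 1) ≠ sq X (b' - l - 1) ∧
      IsConj (FreeGroup.mk (wpow (rotZ X (a : ZMod X.length)) p ++
        wpow (rotZ X (b : ZMod X.length)) q))
        (FreeGroup.mk (nfw (sq X) X.length a' b' l p q)) := by
    intro a b hab
    obtain ⟨a', b', l, hR, hN, hd⟩ := exists_NF hn per red prim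
      (fun i j i' j' => REq pbar X X ((i : ZMod X.length), (j : ZMod X.length))
        ((i' : ZMod X.length), (j' : ZMod X.length)))
      (fun i j => Relation.EqvGen.refl _)
      (fun _ _ _ _ _ _ h1 h2 => Relation.EqvGen.trans _ _ _ h1 h2)
      (fun i j hs => Relation.EqvGen.symm _ _ (Relation.EqvGen.rel _ _
        (Or.inl ⟨by simp, by simpa [sq] using hs⟩)))
      (fun i j hs => Relation.EqvGen.rel _ _ (Or.inr ⟨by simp, by simpa [sq] using hs⟩)) a b hab
    refine ⟨a', b', l, hR, hN, hd, ?_⟩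
    refine (conj_of_REq X h0 p q _ _ hR).trans ?_
    simp only
    rw [hmk]
    exact nfw_conj per hN hp0 hq
  have hND : ∀ a b : ℤ, (X.length : ℤ) ∣ a - b → NF (sq X) X.length a a 0 ∧
      IsConj (FreeGroup.mk (wpow (rotZ X (a : ZMod X.length)) p ++
        wpow (rotZ X (b : ZMod X.length)) q))
        (FreeGroup.mk (nfw (sq X) X.length a a 0 p q)) := by
    intro a b hab
    have hN : NF (sq X) X.length a a 0 := by
      refine ⟨hn, fun t ht => absurd ht (by omega), ?_, ?_⟩
      · have := red (a - 1)
        rw [sub_add_cancel] at this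
        exact ne_pbar_symm this
      · have := red (a - 1)
        rw [sub_add_cancel] at this
        simpa using this
    refine ⟨hN, ?_⟩
    rw [← hcast a b hab, hmk]
    exact nfw_conj per hN hp0 hq
  by_cases hij : (X.length : ℤ) ∣ i - j
  · obtain ⟨N, C⟩ := hND i j hij
    by_cases hkh : (X.length : ℤ) ∣ k - h
    · rw [← hcast i j hij, ← hcast k h hkh]
      exact REq_diag X i k
    · obtain ⟨k', h', l', hR', N', d', C'⟩ := hNF k h hkh
      exact (core_diag hn per N N' hp0 hq d' (conj_rot _ _ (nfw_cyc per red N hp0 hq)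
        (nfw_cyc per red N' hp0 hq) ((C.symm.trans hc).trans C'))).elim
  · obtain ⟨i', j', l, hR, N, d, C⟩ := hNF i j hij
    by_cases hkh : (X.length : ℤ) ∣ k - h
    · obtain ⟨N', C'⟩ := hND k h hkh
      exact (core_diag hn per N' N hp0 hq d (conj_rot _ _ (nfw_cyc per red N' hp0 hq)
        (nfw_cyc per red N hp0 hq) ((C.symm.trans hc).trans C').symm)).elim
    · obtain ⟨k', h', l', hR', N', d', C'⟩ := hNF k h hkh
      obtain ⟨e1, e2⟩ := core hn per red prim N N' hp hq hqp d d'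
        (conj_rot _ _ (nfw_cyc per red N hp0 hq)
        (nfw_cyc per red N' hp0 hq) ((C.symm.trans hc).trans C'))
      rw [hcast _ _ e1, hcast _ _ e2] at hR
      exact Relation.EqvGen.trans _ _ _ hR (Relation.EqvGen.symm _ _ hR')

theorem conj_swap (u v : List (S × Bool)) :
    IsConj (FreeGroup.mk (u ++ v)) (FreeGroup.mk (v ++ u)) := by
  rw [← FreeGroup.mul_mk, ← FreeGroup.mul_mk, isConj_iff]
  exact ⟨(FreeGroup.mk u)⁻¹, by group⟩

end Word

/-- for a primitive cyclically reduced word `X`, inequivalent linking pairs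
give non-conjugate words `(X_i)^p (X_j)^q` and `(X_k)^p (X_h)^q`. -/
theorem statement12 {S : Type*} [Inhabited S] [LinearOrder (S × Bool)]
    (X : List (S × Bool)) (hX : CyclicallyReduced pbar X) (hprim : Primitive X)
    (i j k h : ZMod X.length)
    (hij : sgn pbar X X i j ≠ 0) (hkh : sgn pbar X X k h ≠ 0)
    (hne : ¬ REq pbar X X (i, j) (k, h))
    (p q : ℕ) (hp : 0 < p) (hq : 0 < q) (hpq : p ≠ q) (h3 : 3 ≤ p ∨ 3 ≤ q) :
    ¬ IsConj (FreeGroup.mk (wpow (rotZ X i) p ++ wpow (rotZ X j) q))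
        (FreeGroup.mk (wpow (rotZ X k) p ++ wpow (rotZ X h) q)) := by
  intro hc
  rcases lt_or_gt_of_ne hpq with hlt | hlt
  · have := main_aux X hX hprim j i h k q p (by omega) hp hlt
      (((conj_swap _ _).trans hc).trans (conj_swap _ _))
    exact hne (REq_swap X _ _ this)
  · exact hne (main_aux X hX hprim i j k h p q (by omega) hq hlt hc)

end GoldmanPaper
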